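/- arXiv:1105.1254 — 2 statements merged into one kernel-verified Lean document; each statement's English description precedes it below -/
import Mathlib

section
/- The map ℑ: W_N → End_ℂ(A^N) defined by ℑ(d)(g_1,…,g_N)_i = d(g_i) + Σ_{j=1}^N ∂_i(d(x_j))·g_j is ℂ-linear, injective, and satisfies ℑ([d_1,d_2]) = ℑ(d_1)∘ℑ(d_2) − ℑ(d_2)∘ℑ(d_1) for all d_1, d_2 ∈ W_N; that is, Shen's map ℑ is an injective homomorphism of Lie algebras. -/
open MvPolynomial

noncomputable section

/-- The commutator of a partial derivative with a derivation `d` of a polynomial ring. -/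
theorem pderiv_derivation_apply {σ R : Type*} [Fintype σ] [CommRing R]
    (d : Derivation R (MvPolynomial σ R) (MvPolynomial σ R)) (i : σ) (f : MvPolynomial σ R) :
    pderiv i (d f) = d (pderiv i f) + ∑ k, pderiv i (d (X k)) * pderiv k f := by
  classical
  have h_sum (p : MvPolynomial σ R) :
      (∑ k, pderiv i (d (X k)) • pderiv k : Derivation R (MvPolynomial σ R) (MvPolynomial σ R)) p =
        ∑ k, pderiv i (d (X k)) * pderiv k p := by
    rw [← Derivation.coeFnAddMonoidHom_apply, map_sum, Finset.sum_apply]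
    rfl
  have h : ⁅(pderiv i : Derivation R (MvPolynomial σ R) (MvPolynomial σ R)), d⁆ =
      ∑ k, pderiv i (d (X k)) • pderiv k := by
    refine derivation_ext fun j => ?_
    have hd : d (if j = i then 1 else 0) = 0 := by split_ifs <;> simp
    simp [Derivation.commutator_apply, h_sum, pderiv_X, hd, Pi.single_apply]
  rw [← h_sum, ← h, Derivation.commutator_apply]
  ring

/-- **Shen's monomorphism.** Let `A = ℂ[x_1,…,x_N]` and let `W_N` be the Lie algebra of all
ℂ-linear derivations of `A`.  The map `ℑ : W_N → End_ℂ(A^N)` given by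
`ℑ(d)(g)_i = d(g_i) + Σ_j ∂_i(d(x_j))·g_j` is ℂ-linear, injective, and a Lie algebra
homomorphism for the commutator bracket on `End_ℂ(A^N)`. -/
theorem statement2 (N : ℕ) (hN : 1 ≤ N)
    (Im : Derivation ℂ (MvPolynomial (Fin N) ℂ) (MvPolynomial (Fin N) ℂ) →
      Module.End ℂ (Fin N → MvPolynomial (Fin N) ℂ))
    (hIm : ∀ d g i, Im d g i = d (g i) + ∑ j : Fin N, (pderiv i (d (X j))) * g j) :
    IsLinearMap ℂ Im ∧ Function.Injective Im ∧
      (∀ d₁ d₂, Im ⁅d₁, d₂⁆ = Im d₁ * Im d₂ - Im d₂ * Im d₁) := by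
  refine ⟨⟨fun d₁ d₂ => ?_, fun c d => ?_⟩, fun d₁ d₂ h => ?_, fun d₁ d₂ => ?_⟩
  · refine LinearMap.ext fun g => funext fun i => ?_
    simp only [hIm, LinearMap.add_apply, Pi.add_apply, Derivation.add_apply, map_add, add_mul,
      Finset.sum_add_distrib]
    ring
  · refine LinearMap.ext fun g => funext fun i => ?_
    simp only [hIm, LinearMap.smul_apply, Pi.smul_apply, Derivation.smul_apply, Derivation.map_smul,
      smul_add, Finset.smul_sum, smul_mul_assoc]
  · refine derivation_ext fun k => ?_
    have h_single (p : MvPolynomial (Fin N) ℂ) :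
        d₁ p + pderiv k (d₁ (X k)) * p = d₂ p + pderiv k (d₂ (X k)) * p := by
      have hp := congrFun (LinearMap.congr_fun h (Pi.single k p)) k
      simpa [hIm, Pi.single_apply] using hp
    have h_one : pderiv k (d₁ (X k)) = pderiv k (d₂ (X k)) := by simpa using h_single 1
    simpa [h_one] using h_single (X k)
  · refine LinearMap.ext fun g => funext fun i => ?_
    have h_comp (d e : Derivation ℂ (MvPolynomial (Fin N) ℂ) (MvPolynomial (Fin N) ℂ)) :
        Im d (Im e g) i = d (e (g i)) + ∑ j, pderiv i (d (e (X j))) * g j +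
          ∑ j, (pderiv i (e (X j)) * d (g j) + pderiv i (d (X j)) * e (g j)) := by
      simp only [hIm, map_add, map_sum, Derivation.leibniz, smul_eq_mul, mul_add,
        pderiv_derivation_apply d i (e _), add_mul, Finset.sum_add_distrib, Finset.mul_sum,
        Finset.sum_mul]
      rw [Finset.sum_comm (f := fun k j => pderiv i (d (X k)) * (pderiv k (e (X j)) * g j))]
      simp only [mul_assoc, mul_comm (g _)]
      ring
    simp only [LinearMap.sub_apply, Module.End.mul_apply, Pi.sub_apply, h_comp]
    simp only [hIm, Derivation.commutator_apply, map_sub, sub_mul, Finset.sum_sub_distrib,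
      Finset.sum_add_distrib]
    ring
end
end

section
/- Let Ĉ_{2n} = {d̃ + m_X + m_{f·I} : d ∈ C_{2n}, X ∈ o(2n,A), f ∈ A} ⊆ End_ℂ(A^{2n}), where I is the 2n×2n identity matrix. Then: (i) Ĉ_{2n} is closed under the commutator of operators; (ii) the operator m_I commutes with every element of Ĉ_{2n} (the identity matrix is a central element of Ĉ_{2n}); (iii) for every d ∈ C_{2n}, the operator ℑ(d) defined by ℑ(d)(g_1,…,g_{2n})_i = d(g_i) + Σ_{j=1}^{2n} ∂_i(d(x_j))·g_j belongs to Ĉ_{2n}. -/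
open MvPolynomial Matrix LinearMap TensorProduct

noncomputable section

variable (n : ℕ)

/-- The polynomial algebra `ℂ[x_1,…,x_{2n}]`, indices in `Fin (n+n)`:
`Fin.castAdd n i ↔ x_{i+1}` and `Fin.natAdd n i ↔ x_{n+i+1}`. -/
abbrev PA : Type := MvPolynomial (Fin (n + n)) ℂ

/-- Partial derivative `∂_i` as a linear endomorphism. -/
def pd (i : Fin (n + n)) : Module.End ℂ (PA n) := (pderiv i).toLinearMap

/-- Multiplication by a polynomial, as a linear endomorphism. -/
def mX (f : PA n) : Module.End ℂ (PA n) := LinearMap.mulLeft ℂ f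

/-- Index of `x_i` (`1 ≤ i ≤ n`). -/
def iL (i : Fin n) : Fin (n + n) := Fin.castAdd n i
/-- Index of `x_{n+i}` (`1 ≤ i ≤ n`). -/
def iR (i : Fin n) : Fin (n + n) := Fin.natAdd n i

/-- `η = Σ x_i x_{n+i}`. -/
def eta : PA n := ∑ i : Fin n, X (iL n i) * X (iR n i)

/-- The degree operator `D = Σ x_r ∂_r`. -/
def Dop : Module.End ℂ (PA n) := ∑ r : Fin (n + n), mX n (X r) * pd n r

/-- The involution swapping `i ↔ n+i`. -/
def sw (k : Fin (n + n)) : Fin (n + n) := finSumFinEquiv (Sum.swap (finSumFinEquiv.symm k))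

/-- `J_k = x_k D − η ∂_{sw k}`. -/
def Jop (k : Fin (n + n)) : Module.End ℂ (PA n) :=
  mX n (X k) * Dop n - mX n (eta n) * pd n (sw n k)

/-- `A_{i,j} = x_i∂_j − x_{n+j}∂_{n+i}`. -/
def Aop (i j : Fin n) : Module.End ℂ (PA n) :=
  mX n (X (iL n i)) * pd n (iL n j) - mX n (X (iR n j)) * pd n (iR n i)

/-- `B_{i,j} = x_i∂_{n+j} − x_j∂_{n+i}`. -/
def Bop (i j : Fin n) : Module.End ℂ (PA n) :=
  mX n (X (iL n i)) * pd n (iR n j) - mX n (X (iL n j)) * pd n (iR n i)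

/-- `C_{i,j} = x_{n+i}∂_j − x_{n+j}∂_i`. -/
def Cop (i j : Fin n) : Module.End ℂ (PA n) :=
  mX n (X (iR n i)) * pd n (iL n j) - mX n (X (iR n j)) * pd n (iL n i)
/-- `C_{2n}`: the span of the conformal operators. -/
def C2n : Set (Module.End ℂ (PA n)) :=
  ↑(Submodule.span ℂ
    ({Dop n} ∪ Set.range (pd n) ∪ Set.range (Jop n) ∪
      {d | ∃ i j : Fin n, d = Aop n i j} ∪
      {d | ∃ i j : Fin n, i < j ∧ (d = Bop n i j ∨ d = Cop n i j)}))

/-- The matrix `S = [[0,Iₙ],[Iₙ,0]]` defining `o(2n,A)`. -/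
def Smat : Matrix (Fin (n + n)) (Fin (n + n)) (PA n) :=
  Matrix.of fun i j => if sw n i = j then 1 else 0

/-- A derivation (or any endomorphism) of `A` acting componentwise on `A^{2n}`. -/
def tildeOp (d : Module.End ℂ (PA n)) : Module.End ℂ (Fin (n + n) → PA n) :=
  d.compLeft (Fin (n + n))

/-- Matrix multiplication by `Xm ∈ gl(2n, A)`, as a ℂ-linear endomorphism of `A^{2n}`. -/
def matOp (Xm : Matrix (Fin (n + n)) (Fin (n + n)) (PA n)) :
    Module.End ℂ (Fin (n + n) → PA n) :=
  (Matrix.mulVecLin Xm).restrictScalars ℂ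

/-- The Lie algebra `Ĉ_{2n} = {d̃ + m_X + m_{f·I}}` with `d ∈ C_{2n}`, `X ∈ o(2n,A)`, `f ∈ A`. -/
def Chat2n : Set (Module.End ℂ (Fin (n + n) → PA n)) :=
  {T | ∃ d ∈ C2n n, ∃ Xm : Matrix (Fin (n + n)) (Fin (n + n)) (PA n),
    Xmᵀ * Smat n + Smat n * Xm = 0 ∧
    ∃ f : PA n, T = tildeOp n d + matOp n Xm + matOp n (f • (1 : Matrix (Fin (n + n)) (Fin (n + n)) (PA n)))}

/-- Shen's operator `ℑ(d)(g)_i = d(g_i) + Σ_j ∂_i(d(x_j))·g_j`. -/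
def ShenOf (d : Module.End ℂ (PA n)) : Module.End ℂ (Fin (n + n) → PA n) :=
  tildeOp n d + matOp n (Matrix.of fun i j => pderiv i (d (X j)))

/-- The Euler derivation `D`. -/
def eulerDer : Derivation ℂ (PA n) (PA n) := mkDerivation ℂ X

/-- The bilinear form with matrix `S`, over `ℂ`. -/
def form (k l : Fin (n + n)) : ℂ := if sw n k = l then 1 else 0

/-- The derivation `∂_{sw k}`, dual to `x_k` under the form `S`. -/
def dualDer (k : Fin (n + n)) : Derivation ℂ (PA n) (PA n) := pderiv (sw n k)

/-- The derivation `J_k`. -/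
def specialDer (k : Fin (n + n)) : Derivation ℂ (PA n) (PA n) :=
  (X k : PA n) • eulerDer n - eta n • dualDer n k

/-- The rotation `x_k ∂_{sw l} - x_l ∂_{sw k}`, which specialises to `A_{i,j}`, `B_{i,j}`,
`C_{i,j}`. -/
def rotDer (k l : Fin (n + n)) : Derivation ℂ (PA n) (PA n) :=
  (X k : PA n) • dualDer n l - (X l : PA n) • dualDer n k

@[simp] theorem sw_sw (k : Fin (n + n)) : sw n (sw n k) = k := by
  simp [sw]

@[simp] theorem sw_iL (i : Fin n) : sw n (iL n i) = iR n i := by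
  simp [sw, iL, iR]

@[simp] theorem sw_iR (i : Fin n) : sw n (iR n i) = iL n i := by
  rw [← sw_iL, sw_sw]

theorem sw_eq_iff (k l : Fin (n + n)) : sw n k = l ↔ sw n l = k :=
  ⟨fun h => by rw [← h, sw_sw], fun h => by rw [← h, sw_sw]⟩

theorem exists_iL_or_iR (k : Fin (n + n)) : (∃ i, k = iL n i) ∨ ∃ i, k = iR n i := by
  refine Fin.addCases (fun i => Or.inl ⟨i, rfl⟩) (fun i => Or.inr ⟨i, rfl⟩) k

theorem form_comm (k l : Fin (n + n)) : form n k l = form n l k := by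
  simp only [form, sw_eq_iff n k l]

@[simp] theorem eulerDer_X (m : Fin (n + n)) : eulerDer n (X m) = X m := by
  simp [eulerDer]

@[simp] theorem dualDer_X (k m : Fin (n + n)) : dualDer n k (X m) = C (form n k m) := by
  simp only [dualDer, form, pderiv_X, Pi.single_apply, eq_comm]
  split_ifs <;> simp

@[simp] theorem specialDer_X (k m : Fin (n + n)) :
    specialDer n k (X m) = X k * X m - eta n * C (form n k m) := by
  simp [specialDer]

@[simp] theorem rotDer_X (k l m : Fin (n + n)) :
    rotDer n k l (X m) = X k * C (form n l m) - X l * C (form n k m) := by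
  simp [rotDer]

@[simp] theorem eulerDer_eta : eulerDer n (eta n) = 2 * eta n := by
  simp only [eta, map_sum, Derivation.leibniz, eulerDer_X, smul_eq_mul, Finset.mul_sum]
  exact Finset.sum_congr rfl fun i _ => by ring

@[simp] theorem dualDer_eta (k : Fin (n + n)) : dualDer n k (eta n) = X k := by
  simp only [eta, map_sum, Derivation.leibniz, dualDer_X, smul_eq_mul]
  have hL (i j : Fin n) : iL n i = iL n j ↔ i = j := by simp [iL]
  have hR (i j : Fin n) : iR n i = iR n j ↔ i = j := by simp [iR]
  have hLR (i j : Fin n) : iL n i ≠ iR n j := by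
    simp only [iL, iR, ne_eq, Fin.ext_iff, Fin.val_castAdd, Fin.val_natAdd]; omega
  rcases exists_iL_or_iR n k with ⟨i, rfl⟩ | ⟨i, rfl⟩ <;>
    simp [form, hL, hR, hLR, (hLR _ _).symm, apply_ite C]

@[simp] theorem rotDer_eta (k l : Fin (n + n)) : rotDer n k l (eta n) = 0 := by
  simp [rotDer, mul_comm]

@[simp] theorem specialDer_eta (k : Fin (n + n)) : specialDer n k (eta n) = X k * eta n := by
  simp only [specialDer, Derivation.sub_apply, Derivation.smul_apply, eulerDer_eta, dualDer_eta,
    smul_eq_mul]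
  ring

/-- The conformal derivations of `A`. -/
def confDer : Submodule ℂ (Derivation ℂ (PA n) (PA n)) :=
  Submodule.span ℂ ({eulerDer n} ∪ Set.range (dualDer n) ∪ Set.range (specialDer n) ∪
    {d | ∃ k l, d = rotDer n k l})

section Brackets

variable {n}

theorem eulerDer_mem : eulerDer n ∈ confDer n := Submodule.subset_span (by simp)

theorem dualDer_mem (k : Fin (n + n)) : dualDer n k ∈ confDer n :=
  Submodule.subset_span (by simp)

theorem specialDer_mem (k : Fin (n + n)) : specialDer n k ∈ confDer n :=
  Submodule.subset_span (by simp)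

theorem rotDer_mem (k l : Fin (n + n)) : rotDer n k l ∈ confDer n :=
  Submodule.subset_span (Or.inr ⟨k, l, rfl⟩)

theorem confDer_induction {P : Derivation ℂ (PA n) (PA n) → Prop}
    (euler : P (eulerDer n)) (dual : ∀ k, P (dualDer n k)) (special : ∀ k, P (specialDer n k))
    (rot : ∀ k l, P (rotDer n k l)) (zero : P 0) (add : ∀ d e, P d → P e → P (d + e))
    (smul : ∀ (c : ℂ) d, P d → P (c • d)) {d : Derivation ℂ (PA n) (PA n)}
    (hd : d ∈ confDer n) : P d := by
  induction hd using Submodule.span_induction with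
  | mem d hd =>
    rcases hd with ((rfl | ⟨k, rfl⟩) | ⟨k, rfl⟩) | ⟨k, l, rfl⟩
    exacts [euler, dual k, special k, rot k l]
  | zero => exact zero
  | add d e _ _ hd he => exact add d e hd he
  | smul c d _ hd => exact smul c d hd

theorem lie_euler_dual (k : Fin (n + n)) : ⁅eulerDer n, dualDer n k⁆ = -dualDer n k :=
  derivation_ext fun m => by simp [Derivation.commutator_apply]

theorem lie_euler_special (k : Fin (n + n)) : ⁅eulerDer n, specialDer n k⁆ = specialDer n k :=
  derivation_ext fun m => by
    simp [Derivation.commutator_apply]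
    ring

theorem lie_euler_rot (k l : Fin (n + n)) : ⁅eulerDer n, rotDer n k l⁆ = 0 :=
  derivation_ext fun m => by
    simp [Derivation.commutator_apply]
    ring

theorem lie_dual_dual (k l : Fin (n + n)) : ⁅dualDer n k, dualDer n l⁆ = 0 :=
  derivation_ext fun m => by simp [Derivation.commutator_apply]

theorem lie_dual_special (k l : Fin (n + n)) :
    ⁅dualDer n k, specialDer n l⁆ = form n k l • eulerDer n - rotDer n k l :=
  derivation_ext fun m => by
    simp [Derivation.commutator_apply, smul_eq_C_mul]
    ring

theorem lie_rot_dual (k l m : Fin (n + n)) :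
    ⁅rotDer n k l, dualDer n m⁆ = form n m l • dualDer n k - form n m k • dualDer n l :=
  derivation_ext fun r => by
    simp [Derivation.commutator_apply, smul_eq_C_mul]
    ring

theorem lie_special_special (k l : Fin (n + n)) : ⁅specialDer n k, specialDer n l⁆ = 0 :=
  derivation_ext fun m => by
    simp [Derivation.commutator_apply, form_comm n l k]
    ring

theorem lie_rot_special (k l m : Fin (n + n)) :
    ⁅rotDer n k l, specialDer n m⁆ = form n l m • specialDer n k - form n k m • specialDer n l :=
  derivation_ext fun r => by
    simp [Derivation.commutator_apply, smul_eq_C_mul, form_comm n m]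
    ring

theorem lie_rot_rot (k l r s : Fin (n + n)) :
    ⁅rotDer n k l, rotDer n r s⁆ = form n l r • rotDer n k s - form n k r • rotDer n l s +
      form n l s • rotDer n r k - form n k s • rotDer n r l :=
  derivation_ext fun m => by
    simp [Derivation.commutator_apply, smul_eq_C_mul, form_comm n r, form_comm n s]
    ring

theorem lie_mem_confDer {d e : Derivation ℂ (PA n) (PA n)} (hd : d ∈ confDer n)
    (he : e ∈ confDer n) : ⁅d, e⁆ ∈ confDer n := by
  have swap {a b : Derivation ℂ (PA n) (PA n)} (h : ⁅a, b⁆ ∈ confDer n) : ⁅b, a⁆ ∈ confDer n := by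
    rw [← lie_skew]
    exact neg_mem h
  have ed (k) : ⁅eulerDer n, dualDer n k⁆ ∈ confDer n := by
    rw [lie_euler_dual]
    exact neg_mem (dualDer_mem k)
  have es (k) : ⁅eulerDer n, specialDer n k⁆ ∈ confDer n := by
    rw [lie_euler_special]
    exact specialDer_mem k
  have er (k l) : ⁅eulerDer n, rotDer n k l⁆ ∈ confDer n := by
    rw [lie_euler_rot]
    exact zero_mem _
  have ds (k l) : ⁅dualDer n k, specialDer n l⁆ ∈ confDer n := by
    rw [lie_dual_special]
    exact sub_mem (Submodule.smul_mem _ _ eulerDer_mem) (rotDer_mem k l)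
  have rd (k l m) : ⁅rotDer n k l, dualDer n m⁆ ∈ confDer n := by
    rw [lie_rot_dual]
    exact sub_mem (Submodule.smul_mem _ _ (dualDer_mem k)) (Submodule.smul_mem _ _ (dualDer_mem l))
  have rs (k l m) : ⁅rotDer n k l, specialDer n m⁆ ∈ confDer n := by
    rw [lie_rot_special]
    exact sub_mem (Submodule.smul_mem _ _ (specialDer_mem k))
      (Submodule.smul_mem _ _ (specialDer_mem l))
  have rr (k l r s) : ⁅rotDer n k l, rotDer n r s⁆ ∈ confDer n := by
    rw [lie_rot_rot]
    exact sub_mem (add_mem (sub_mem (Submodule.smul_mem _ _ (rotDer_mem _ _))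
      (Submodule.smul_mem _ _ (rotDer_mem _ _))) (Submodule.smul_mem _ _ (rotDer_mem _ _)))
      (Submodule.smul_mem _ _ (rotDer_mem _ _))
  have dd (k l) : ⁅dualDer n k, dualDer n l⁆ ∈ confDer n := by
    rw [lie_dual_dual]
    exact zero_mem _
  have ss (k l) : ⁅specialDer n k, specialDer n l⁆ ∈ confDer n := by
    rw [lie_special_special]
    exact zero_mem _
  have extend {a b : Derivation ℂ (PA n) (PA n)} (hb : b ∈ confDer n)
      (h₁ : ⁅a, eulerDer n⁆ ∈ confDer n) (h₂ : ∀ k, ⁅a, dualDer n k⁆ ∈ confDer n)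
      (h₃ : ∀ k, ⁅a, specialDer n k⁆ ∈ confDer n)
      (h₄ : ∀ k l, ⁅a, rotDer n k l⁆ ∈ confDer n) : ⁅a, b⁆ ∈ confDer n :=
    confDer_induction (P := fun b => ⁅a, b⁆ ∈ confDer n) h₁ h₂ h₃ h₄
      (by rw [show ⁅a, (0 : Derivation ℂ (PA n) (PA n))⁆ = 0 from lie_zero a]; exact zero_mem _)
      (fun b c hb hc => by rw [LieRing.lie_add]; exact add_mem hb hc)
      (fun c b hb => by
        rw [show ⁅a, c • b⁆ = c • ⁅a, b⁆ from lie_smul c a b]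
        exact Submodule.smul_mem _ _ hb) hb
  refine swap (extend hd ?_ ?_ ?_ ?_)
  · exact swap (extend he (by rw [LieRing.lie_self]; exact zero_mem _) ed es er)
  · exact fun k => swap (extend he (swap (ed k)) (dd k) (ds k) fun l m => swap (rd l m k))
  · exact fun k => swap (extend he (swap (es k)) (fun l => swap (ds l k)) (ss k)
      fun l m => swap (rs l m k))
  · exact fun k l => swap (extend he (swap (er k l)) (rd k l) (rs k l) (rr k l))

end Brackets

theorem coe_eulerDer : (eulerDer n : Module.End ℂ (PA n)) = Dop n := by
  have hsum (d : Fin (n + n) → Derivation ℂ (PA n) (PA n)) (f : PA n) :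
      (∑ r, d r) f = ∑ r, d r f := by
    rw [← Derivation.coeFnAddMonoidHom_apply, map_sum, Finset.sum_apply]
    rfl
  have h : eulerDer n = ∑ r, (X r : PA n) • pderiv (R := ℂ) r :=
    derivation_ext fun m => by
      simp [hsum, pderiv_X, Pi.single_apply]
  refine LinearMap.ext fun f => ?_
  simp [h, hsum, Dop, mX, pd, LinearMap.sum_apply]

theorem coe_dualDer (k : Fin (n + n)) : (dualDer n k : Module.End ℂ (PA n)) = pd n (sw n k) := rfl

theorem coe_specialDer (k : Fin (n + n)) :
    (specialDer n k : Module.End ℂ (PA n)) = Jop n k := by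
  rw [Jop, ← coe_eulerDer, ← coe_dualDer]
  rfl

theorem coe_rotDer (k l : Fin (n + n)) :
    (rotDer n k l : Module.End ℂ (PA n)) =
      mX n (X k) * pd n (sw n l) - mX n (X l) * pd n (sw n k) := rfl

theorem rotDer_swap (k l : Fin (n + n)) : rotDer n l k = -rotDer n k l := by
  simp [rotDer]

theorem coe_rotDer_iL_iR (i j : Fin n) :
    (rotDer n (iL n i) (iR n j) : Module.End ℂ (PA n)) = Aop n i j := by
  simp [coe_rotDer, Aop]

theorem coe_rotDer_iL_iL (i j : Fin n) :
    (rotDer n (iL n i) (iL n j) : Module.End ℂ (PA n)) = Bop n i j := by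
  simp [coe_rotDer, Bop]

theorem coe_rotDer_iR_iR (i j : Fin n) :
    (rotDer n (iR n i) (iR n j) : Module.End ℂ (PA n)) = Cop n i j := by
  simp [coe_rotDer, Cop]

theorem coe_rotDer_mem_C2n (k l : Fin (n + n)) :
    (rotDer n k l : Module.End ℂ (PA n)) ∈ C2n n := by
  have antisymm {k l} (h : (rotDer n k l : Module.End ℂ (PA n)) ∈ C2n n) :
      (rotDer n l k : Module.End ℂ (PA n)) ∈ C2n n := by
    rw [rotDer_swap, Derivation.coe_neg_linearMap]
    exact Submodule.neg_mem _ h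
  have diag (k) : (rotDer n k k : Module.End ℂ (PA n)) ∈ C2n n := by
    rw [coe_rotDer, sub_self]
    exact Submodule.zero_mem _
  have hA (i j) : (rotDer n (iL n i) (iR n j) : Module.End ℂ (PA n)) ∈ C2n n := by
    rw [coe_rotDer_iL_iR]
    exact Submodule.subset_span (Or.inl (Or.inr ⟨i, j, rfl⟩))
  have hB {i j} (h : i < j) : (rotDer n (iL n i) (iL n j) : Module.End ℂ (PA n)) ∈ C2n n := by
    rw [coe_rotDer_iL_iL]
    exact Submodule.subset_span (Or.inr ⟨i, j, h, Or.inl rfl⟩)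
  have hC {i j} (h : i < j) : (rotDer n (iR n i) (iR n j) : Module.End ℂ (PA n)) ∈ C2n n := by
    rw [coe_rotDer_iR_iR]
    exact Submodule.subset_span (Or.inr ⟨i, j, h, Or.inr rfl⟩)
  rcases exists_iL_or_iR n k with ⟨i, rfl⟩ | ⟨i, rfl⟩ <;>
    rcases exists_iL_or_iR n l with ⟨j, rfl⟩ | ⟨j, rfl⟩
  · rcases lt_trichotomy i j with h | rfl | h
    exacts [hB h, diag _, antisymm (hB h)]
  · exact hA i j
  · exact antisymm (hA j i)
  · rcases lt_trichotomy i j with h | rfl | h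
    exacts [hC h, diag _, antisymm (hC h)]

theorem coe_mem_C2n {d : Derivation ℂ (PA n) (PA n)} (hd : d ∈ confDer n) :
    (d : Module.End ℂ (PA n)) ∈ C2n n := by
  refine confDer_induction (P := fun d => (d : Module.End ℂ (PA n)) ∈ C2n n)
    ?_ ?_ ?_ (coe_rotDer_mem_C2n n) (Submodule.zero_mem _)
    (fun d e hd he => Submodule.add_mem _ hd he) (fun c d hd => Submodule.smul_mem _ c hd) hd
  · rw [coe_eulerDer]
    exact Submodule.subset_span (by simp)
  · exact fun k => Submodule.subset_span (by simp [coe_dualDer])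
  · exact fun k => Submodule.subset_span (by simp [coe_specialDer])

theorem exists_confDer_of_mem_C2n {d : Module.End ℂ (PA n)} (hd : d ∈ C2n n) :
    ∃ e ∈ confDer n, (e : Module.End ℂ (PA n)) = d := by
  induction hd using Submodule.span_induction with
  | mem d hd =>
    rcases hd with (((rfl | ⟨k, rfl⟩) | ⟨k, rfl⟩) | ⟨i, j, rfl⟩) | ⟨i, j, -, rfl | rfl⟩
    · exact ⟨_, eulerDer_mem, coe_eulerDer n⟩
    · exact ⟨_, dualDer_mem (sw n k), by rw [coe_dualDer, sw_sw]⟩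
    · exact ⟨_, specialDer_mem k, coe_specialDer n k⟩
    · exact ⟨_, rotDer_mem _ _, coe_rotDer_iL_iR n i j⟩
    · exact ⟨_, rotDer_mem _ _, coe_rotDer_iL_iL n i j⟩
    · exact ⟨_, rotDer_mem _ _, coe_rotDer_iR_iR n i j⟩
  | zero => exact ⟨0, zero_mem _, rfl⟩
  | add d e _ _ hd he =>
    obtain ⟨d, hd, rfl⟩ := hd
    obtain ⟨e, he, rfl⟩ := he
    exact ⟨d + e, add_mem hd he, rfl⟩
  | smul c d _ hd =>
    obtain ⟨d, hd, rfl⟩ := hd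
    exact ⟨c • d, Submodule.smul_mem _ c hd, rfl⟩

/-- Entrywise description of `o(2n, A)`. -/
theorem orthogonal_iff (Y : Matrix (Fin (n + n)) (Fin (n + n)) (PA n)) :
    Yᵀ * Smat n + Smat n * Y = 0 ↔ ∀ i j, Y (sw n j) i + Y (sw n i) j = 0 := by
  rw [← Matrix.ext_iff]
  simp [Matrix.mul_apply, Smat, sw_eq_iff n _ _]

theorem orthogonal_map {Y : Matrix (Fin (n + n)) (Fin (n + n)) (PA n)}
    (hY : Yᵀ * Smat n + Smat n * Y = 0) (d : Module.End ℂ (PA n)) :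
    (Y.map d)ᵀ * Smat n + Smat n * Y.map d = 0 := by
  rw [orthogonal_iff] at hY ⊢
  intro i j
  rw [Matrix.map_apply, Matrix.map_apply, ← map_add, hY, map_zero]

theorem orthogonal_commutator {Y Z : Matrix (Fin (n + n)) (Fin (n + n)) (PA n)}
    (hY : Yᵀ * Smat n + Smat n * Y = 0) (hZ : Zᵀ * Smat n + Smat n * Z = 0) :
    (Y * Z - Z * Y)ᵀ * Smat n + Smat n * (Y * Z - Z * Y) = 0 := by
  have key : (Y * Z - Z * Y)ᵀ * Smat n + Smat n * (Y * Z - Z * Y) =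
      Zᵀ * (Yᵀ * Smat n + Smat n * Y) - Yᵀ * (Zᵀ * Smat n + Smat n * Z)
        - (Zᵀ * Smat n + Smat n * Z) * Y + (Yᵀ * Smat n + Smat n * Y) * Z := by
    rw [Matrix.transpose_sub, Matrix.transpose_mul, Matrix.transpose_mul]
    noncomm_ring
  rw [key, hY, hZ]
  simp

theorem matOp_add (Y Z : Matrix (Fin (n + n)) (Fin (n + n)) (PA n)) :
    matOp n (Y + Z) = matOp n Y + matOp n Z :=
  LinearMap.ext fun g => Matrix.add_mulVec Y Z g

theorem matOp_sub (Y Z : Matrix (Fin (n + n)) (Fin (n + n)) (PA n)) :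
    matOp n (Y - Z) = matOp n Y - matOp n Z :=
  LinearMap.ext fun g => Matrix.sub_mulVec Y Z g

theorem matOp_mul (Y Z : Matrix (Fin (n + n)) (Fin (n + n)) (PA n)) :
    matOp n (Y * Z) = matOp n Y * matOp n Z :=
  LinearMap.ext fun g => (Matrix.mulVec_mulVec g Y Z).symm

theorem matOp_one : matOp n 1 = 1 :=
  LinearMap.ext fun g => Matrix.one_mulVec g

theorem tildeOp_lie (d e : Derivation ℂ (PA n) (PA n)) :
    tildeOp n (⁅d, e⁆ : Derivation ℂ (PA n) (PA n)) =
      tildeOp n d * tildeOp n e - tildeOp n e * tildeOp n d := by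
  refine LinearMap.ext fun g => funext fun i => ?_
  exact Derivation.commutator_apply (g i)

theorem tildeOp_mul_matOp (d : Derivation ℂ (PA n) (PA n))
    (Y : Matrix (Fin (n + n)) (Fin (n + n)) (PA n)) :
    tildeOp n d * matOp n Y = matOp n Y * tildeOp n d + matOp n (Y.map d) := by
  refine LinearMap.ext fun g => funext fun i => ?_
  simp only [tildeOp, matOp, Module.End.mul_apply, LinearMap.add_apply, Pi.add_apply,
    LinearMap.compLeft_apply, LinearMap.restrictScalars_apply, Matrix.mulVecLin_apply,
    Matrix.mulVec, dotProduct, Function.comp_apply, Derivation.coeFn_coe, map_sum,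
    Derivation.leibniz, smul_eq_mul, Matrix.map_apply, ← Finset.sum_add_distrib]
  exact Finset.sum_congr rfl fun j _ => by ring

theorem map_smul_one (d : Derivation ℂ (PA n) (PA n)) (f : PA n) :
    (f • (1 : Matrix (Fin (n + n)) (Fin (n + n)) (PA n))).map d = d f • 1 := by
  ext1 i j
  by_cases h : i = j <;> simp [h]

theorem commutator_mem_Chat2n {T₁ T₂ : Module.End ℂ (Fin (n + n) → PA n)}
    (h₁ : T₁ ∈ Chat2n n) (h₂ : T₂ ∈ Chat2n n) : T₁ * T₂ - T₂ * T₁ ∈ Chat2n n := by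
  obtain ⟨_, hd', Y, hY, f, rfl⟩ := h₁
  obtain ⟨_, he', Z, hZ, h, rfl⟩ := h₂
  obtain ⟨d, hd, rfl⟩ := exists_confDer_of_mem_C2n n hd'
  obtain ⟨e, he, rfl⟩ := exists_confDer_of_mem_C2n n he'
  refine ⟨_, coe_mem_C2n n (lie_mem_confDer hd he), Z.map d - Y.map e + (Y * Z - Z * Y), ?_,
    d h - e f, ?_⟩
  · have hZd := orthogonal_map n hZ d
    have hYe := orthogonal_map n hY e
    have hYZ := orthogonal_commutator n hY hZ
    rw [orthogonal_iff] at *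
    intro i j
    simp only [Matrix.add_apply (Z.map d - Y.map e), Matrix.sub_apply (Z.map d)]
    linear_combination hZd i j - hYe i j + hYZ i j
  · have hfZ : matOp n (f • 1) * matOp n Z = matOp n Z * matOp n (f • 1) := by
      simp [← matOp_mul]
    have hYh : matOp n Y * matOp n (h • 1) = matOp n (h • 1) * matOp n Y := by
      simp [← matOp_mul]
    have hfh : matOp n (f • 1) * matOp n (h • 1) = matOp n (h • 1) * matOp n (f • 1) := by
      simp [← matOp_mul, smul_smul, mul_comm]
    simp only [tildeOp_lie, matOp_add, matOp_sub, matOp_mul, sub_smul, ← map_smul_one, mul_add,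
      add_mul, tildeOp_mul_matOp, hfZ, hYh, hfh]
    abel

/-- The conformal Killing equation satisfied by the elements of `confDer`. -/
theorem exists_conformal_factor {d : Derivation ℂ (PA n) (PA n)} (hd : d ∈ confDer n) :
    ∃ f : PA n, ∀ i j, dualDer n i (d (X j)) + dualDer n j (d (X i)) =
      2 * f * C (form n i j) := by
  refine confDer_induction (P := fun d => ∃ f : PA n, ∀ i j,
    dualDer n i (d (X j)) + dualDer n j (d (X i)) = 2 * f * C (form n i j)) ?_ ?_ ?_ ?_ ?_ ?_ ?_ hd
  · exact ⟨1, fun i j => by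
      simp only [eulerDer_X, dualDer_X, form_comm n j i]
      ring⟩
  · exact fun k => ⟨0, fun i j => by simp⟩
  · exact fun k => ⟨X k, fun i j => by
      simp [form_comm n j i, form_comm n k]
      ring⟩
  · exact fun k l => ⟨0, fun i j => by
      simp [form_comm n k, form_comm n l]
      ring⟩
  · exact ⟨0, fun i j => by simp⟩
  · rintro d e ⟨f, hf⟩ ⟨h, hh⟩
    exact ⟨f + h, fun i j => by
      simp only [Derivation.add_apply, map_add]
      linear_combination hf i j + hh i j⟩
  · rintro c d ⟨f, hf⟩
    exact ⟨c • f, fun i j => by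
      simp only [Derivation.smul_apply, Derivation.map_smul, ← smul_add, hf]
      simp only [smul_eq_C_mul]
      ring⟩

theorem ShenOf_mem_Chat2n {d : Module.End ℂ (PA n)} (hd : d ∈ C2n n) :
    ShenOf n d ∈ Chat2n n := by
  obtain ⟨e, he, rfl⟩ := exists_confDer_of_mem_C2n n hd
  obtain ⟨f, hf⟩ := exists_conformal_factor n he
  refine ⟨e, hd, (Matrix.of fun i j => pderiv i (e (X j))) - f • 1, ?_, f, ?_⟩
  · rw [orthogonal_iff]
    intro i j
    have hij := hf i j
    simp only [dualDer, form, apply_ite C, map_one, map_zero] at hij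
    simp only [Matrix.sub_apply, Matrix.of_apply, Matrix.smul_apply, Matrix.one_apply, smul_eq_mul,
      sw_eq_iff n j i]
    linear_combination hij
  · rw [matOp_sub, ShenOf]
    simp only [Derivation.coeFn_coe]
    abel

theorem statement3 (hn : 2 ≤ n) :
    (∀ T₁ ∈ Chat2n n, ∀ T₂ ∈ Chat2n n, T₁ * T₂ - T₂ * T₁ ∈ Chat2n n) ∧
    (∀ T ∈ Chat2n n,
      T * matOp n (1 : Matrix (Fin (n + n)) (Fin (n + n)) (PA n))
        = matOp n (1 : Matrix (Fin (n + n)) (Fin (n + n)) (PA n)) * T) ∧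
    (∀ d ∈ C2n n, ShenOf n d ∈ Chat2n n) :=
  ⟨fun _ h₁ _ h₂ => commutator_mem_Chat2n n h₁ h₂,
    fun T _ => by rw [matOp_one, mul_one, one_mul],
    fun _ hd => ShenOf_mem_Chat2n n hd⟩
end
end
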